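/- arXiv:math/0611353 — 3 statements merged into one kernel-verified Lean document; each statement's English description precedes it below -/
import Mathlib

section
/- Let 𝒫 = {I_l : l ∈ ℕ} be a partition of ℕ such that each I_l contains infinitely many pairs of consecutive integers, and define the cardinal 𝔡'(𝒫) as the least cardinality of a set Y ⊆ ℕ^ℕ such that no single increasing h : ℕ → ℕ satisfies: for each f ∈ Y and each l, there are infinitely many n with n, n+1 ∈ I_l ∩ {m : f(h(m)) < h(m+1)}. Then cov(ℳ) ≤ 𝔡'(𝒫), where cov(ℳ) is the least cardinality of a family of meager subsets of ℕ^ℕ covering ℕ^ℕ. -/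
open Filter

/-- `cov(ℳ)`: the least cardinality of a family of meager subsets of the Baire
space `ℕ^ℕ` covering it. -/
noncomputable def covMeager : Cardinal :=
  sInf {c : Cardinal | ∃ S : Set (Set (ℕ → ℕ)), Cardinal.mk S = c ∧
    (∀ A ∈ S, IsMeagre A) ∧ ⋃₀ S = Set.univ}

/-- `𝔡'(𝒫)` for a partition `𝒫 = {I l}`: the least cardinality of `Y ⊆ ℕ^ℕ`
not admitting an increasing `h` such that for each `f ∈ Y` and `l` there are
infinitely many `n` with `n, n+1 ∈ I l ∩ {m | f (h m) < h (m+1)}`. -/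
noncomputable def dPrime (I : ℕ → Set ℕ) : Cardinal :=
  sInf {c : Cardinal | ∃ Y : Set (ℕ → ℕ), Cardinal.mk Y = c ∧
    ¬ ∃ h : ℕ → ℕ, StrictMono h ∧ ∀ f ∈ Y, ∀ l,
      {n : ℕ | n ∈ I l ∧ n + 1 ∈ I l ∧
        f (h n) < h (n + 1) ∧ f (h (n + 1)) < h (n + 2)}.Infinite}

def hOf (x : ℕ → ℕ) (n : ℕ) : ℕ := ∑ i ∈ Finset.range n, (x i + 1)

theorem hOf_succ (x : ℕ → ℕ) (n : ℕ) : hOf x (n + 1) = hOf x n + (x n + 1) :=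
  Finset.sum_range_succ _ _

theorem hOf_strictMono (x : ℕ → ℕ) : StrictMono (hOf x) :=
  strictMono_nat_of_lt_succ fun n => by rw [hOf_succ]; omega

theorem hOf_continuous (n : ℕ) : Continuous fun x : ℕ → ℕ => hOf x n := by
  unfold hOf
  fun_prop

def goodSet (f : ℕ → ℕ) (J : Set ℕ) (k : ℕ) : Set (ℕ → ℕ) :=
  {x | ∃ n, k ≤ n ∧ (n ∈ J ∧ n + 1 ∈ J ∧
    f (hOf x n) < hOf x (n + 1) ∧ f (hOf x (n + 1)) < hOf x (n + 2))}

theorem goodSet_open (f : ℕ → ℕ) (J : Set ℕ) (k : ℕ) : IsOpen (goodSet f J k) := by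
  have hf : Continuous f := continuous_of_discreteTopology
  unfold goodSet
  simp only [Set.ofPred_exists, Set.ofPred_and]
  refine isOpen_iUnion fun n => ?_
  refine isOpen_const.inter (isOpen_const.inter (isOpen_const.inter (IsOpen.inter ?_ ?_)))
  · exact isOpen_lt (hf.comp (hOf_continuous n)) (hOf_continuous (n + 1))
  · exact isOpen_lt (hf.comp (hOf_continuous (n + 1))) (hOf_continuous (n + 2))

theorem goodSet_dense (f : ℕ → ℕ) (J : Set ℕ) (k : ℕ)
    (hJ : {n : ℕ | n ∈ J ∧ n + 1 ∈ J}.Infinite) : Dense (goodSet f J k) := by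
  intro x
  let y : ℕ → ℕ → ℕ := fun n i => if i < n then x i else if i = n then f (hOf x n)
    else f (hOf x n + (f (hOf x n) + 1))
  have hy : Tendsto y atTop (nhds x) := by
    rw [tendsto_pi_nhds]
    intro i
    refine tendsto_const_nhds.congr' ?_
    filter_upwards [eventually_gt_atTop i] with n hn
    simp [y, hn]
  refine mem_closure_of_frequently_of_tendsto ?_ hy
  have h1 := Nat.frequently_atTop_iff_infinite.2 hJ
  refine (h1.and_eventually (eventually_ge_atTop k)).mono ?_
  rintro n ⟨⟨h2, h3⟩, hk⟩
  have e0 : hOf (y n) n = hOf x n :=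
    Finset.sum_congr rfl fun i hi => by simp [y, Finset.mem_range.1 hi]
  have e1 : hOf (y n) (n + 1) = hOf x n + (f (hOf x n) + 1) := by
    rw [hOf_succ, e0]; simp [y]
  have e2 : hOf (y n) (n + 2) = hOf x n + (f (hOf x n) + 1) +
      (f (hOf x n + (f (hOf x n) + 1)) + 1) := by
    rw [hOf_succ, e1]; simp [y]
  refine ⟨n, hk, h2, h3, ?_, ?_⟩
  · rw [e0, e1]; omega
  · rw [e1, e2]; omega

theorem stmt10 (I : ℕ → Set ℕ)
    (hpart : ∀ n : ℕ, ∃! l, n ∈ I l)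
    (hpairs : ∀ l, {n : ℕ | n ∈ I l ∧ n + 1 ∈ I l}.Infinite) :
    covMeager ≤ dPrime I := by
  unfold dPrime
  refine le_csInf ?_ ?_
  · refine ⟨_, Set.univ, rfl, ?_⟩
    rintro ⟨h, hm, hh⟩
    obtain ⟨n, -, -, h1, -⟩ := (hh (fun x => h (x + 1)) trivial 0).nonempty
    have h2 : h (n + 1) ≤ h (h n + 1) := hm.monotone (Nat.succ_le_succ hm.le_apply)
    exact absurd h1 (not_lt.2 h2)
  · rintro c ⟨Y, rfl, hY⟩
    let A : (ℕ → ℕ) → Set (ℕ → ℕ) := fun f => (⋂ l, ⋂ k, goodSet f (I l) k)ᶜ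
    refine le_trans (csInf_le' ⟨A '' Y, rfl, ?_, ?_⟩) Cardinal.mk_image_le
    · rintro _ ⟨f, -, rfl⟩
      simp only [A, IsMeagre, compl_compl]
      refine countable_iInter_mem.2 fun l => countable_iInter_mem.2 fun k => ?_
      exact residual_of_dense_open (goodSet_open f _ k) (goodSet_dense f _ k (hpairs l))
    · refine Set.eq_univ_of_forall fun x => ?_
      by_contra hx
      apply hY
      refine ⟨hOf x, hOf_strictMono x, fun f hf l => ?_⟩
      have hxf : x ∈ ⋂ l, ⋂ k, goodSet f (I l) k := by
        by_contra h
        exact hx ⟨A f, ⟨f, hf, rfl⟩, h⟩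
      rw [← Nat.frequently_atTop_iff_infinite, frequently_atTop]
      intro k
      obtain ⟨n, hk, hn⟩ := Set.mem_iInter.1 (Set.mem_iInter.1 hxf l) k
      exact ⟨n, hk, hn⟩
end

section
/- Assuming the Continuum Hypothesis, there exists a Menger-bounded metrizable topological group (a subgroup of ℤ^ℕ) that is not Scheepers-bounded. -/
open Pointwise Filter Topology

def MengerBoundedAdd (G : Type*) [AddGroup G] [TopologicalSpace G] : Prop :=
  ∀ U : ℕ → Set G, (∀ n, U n ∈ 𝓝 (0 : G)) →
    ∃ F : ℕ → Finset G, ∀ g : G, ∃ n, g ∈ (F n : Set G) + U n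

def ScheepersBoundedAdd (G : Type*) [AddGroup G] [TopologicalSpace G] : Prop :=
  ∀ U : ℕ → Set G, (∀ n, U n ∈ 𝓝 (0 : G)) →
    ∃ F : ℕ → Finset G, ∀ S : Finset G, ∃ n, (S : Set G) ⊆ (F n : Set G) + U n

def OKp (k : ℕ → ℕ) (f : ℕ → ℤ) (x : ℕ → ℤ) : Prop :=
  ∀ C : ℕ, ∃ n, ∀ i ≤ k n, |x i| + C ≤ f n

lemma step1 (H : Set (ℕ → ℤ)) (hH : H.Countable) (k : ℕ → ℕ) :
    ∃ f : ℕ → ℤ, ∀ x ∈ H, OKp k f x := by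
  rcases H.eq_empty_or_nonempty with rfl | hne
  · exact ⟨0, by simp⟩
  obtain ⟨e, rfl⟩ := hH.exists_eq_range hne
  refine ⟨fun n => n + ∑ j ∈ Finset.range (n+1), ∑ i ∈ Finset.range (k n + 1), |e j i|, ?_⟩
  rintro _ ⟨j, rfl⟩ C
  obtain ⟨M, hjM, hCM⟩ : ∃ M, j ≤ M ∧ C ≤ M := ⟨max j C, le_max_left _ _, le_max_right _ _⟩
  refine ⟨M, fun i hi => ?_⟩
  have h1 : |e j i| ≤ ∑ i ∈ Finset.range (k M + 1), |e j i| :=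
    Finset.single_le_sum (f := fun i => |e j i|) (fun _ _ => abs_nonneg _)
      (Finset.mem_range.2 (by omega))
  have h2 : ∑ i ∈ Finset.range (k M + 1), |e j i| ≤
      ∑ j ∈ Finset.range (M + 1), ∑ i ∈ Finset.range (k M + 1), |e j i| :=
    Finset.single_le_sum (f := fun j => ∑ i ∈ Finset.range (k M + 1), |e j i|)
      (fun _ _ => Finset.sum_nonneg fun _ _ => abs_nonneg _)
      (Finset.mem_range.2 (by omega))
  have h3 : (C : ℤ) ≤ (M : ℤ) := by exact_mod_cast hCM
  dsimp only
  linarith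

lemma step2 (H : Set (ℕ → ℤ)) (hH : H.Countable) (P : Set ((ℕ → ℕ) × (ℕ → ℤ)))
    (hP : P.Countable) (hOK : ∀ p ∈ P, ∀ x ∈ H, OKp p.1 p.2 x) (t : ℕ → ℕ) :
    ∃ g h : ℕ → ℤ, (∀ i, (t i : ℤ) < |g i| ∨ (t i : ℤ) < |h i|) ∧
      ∀ p ∈ P, ∀ x ∈ H, ∀ a b : ℤ, OKp p.1 p.2 (x + a • g + b • h) := by
  have hc := hH.to_subtype
  have hc2 := hP.to_subtype
  rcases isEmpty_or_nonempty (P × H × ℤ × ℤ × ℕ) with hE | hne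
  · refine ⟨fun i => t i + 1, 0, fun i => Or.inl ?_, fun p hp x hx => ?_⟩
    · exact lt_of_lt_of_le (by simp) (le_abs_self _)
    · exact (hE.false (⟨p, hp⟩, ⟨x, hx⟩, 0, 0, 0)).elim
  obtain ⟨e, he⟩ := exists_surjective_nat (P × H × ℤ × ℤ × ℕ)
  let S := ℕ × {w : ℕ → ℤ × ℤ // ∀ i, (t i : ℤ) < |(w i).1| ∨ (t i : ℤ) < |(w i).2|}
  have key : ∀ (q : P × H × ℤ × ℤ × ℕ) (s : S), ∃ s' : S, s.1 < s'.1 ∧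
      (∀ i < s.1, s'.2.1 i = s.2.1 i) ∧
      ∃ n, q.1.1.1 n < s'.1 ∧ ∀ i ≤ q.1.1.1 n,
        |q.2.1.1 i + q.2.2.1 * (s'.2.1 i).1 + q.2.2.2.1 * (s'.2.1 i).2| + q.2.2.2.2
          ≤ q.1.1.2 n := by
    rintro ⟨⟨p, hp⟩, ⟨x, hx⟩, a, b, C⟩ ⟨N, w, hw⟩
    obtain ⟨d1, d2, hd, hd0⟩ : ∃ d1 d2 : ℤ, (1 ≤ |d1| ∨ 1 ≤ |d2|) ∧ a * d1 + b * d2 = 0 := by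
      by_cases h : a = 0
      · exact ⟨1, 0, by simp, by simp [h]⟩
      · exact ⟨b, -a, Or.inr (by rw [abs_neg]; exact Int.one_le_abs h), by ring⟩
    have hbig : ∀ i, ∀ d : ℤ, 1 ≤ |d| → (t i : ℤ) < |((t i : ℤ) + 1) * d| := by
      intro i d h
      rw [abs_mul, abs_of_nonneg (by positivity : (0:ℤ) ≤ (t i : ℤ) + 1)]
      nlinarith [Int.natCast_nonneg (t i)]
    let B : ℤ := ∑ i ∈ Finset.range N, |a * (w i).1 + b * (w i).2|
    have hB : 0 ≤ B := Finset.sum_nonneg fun _ _ => abs_nonneg _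
    obtain ⟨n, hn⟩ := hOK p hp x hx (B.toNat + C)
    have hBn : ((B.toNat + C : ℕ) : ℤ) = B + C := by
      push_cast; rw [Int.toNat_of_nonneg hB]
    rw [hBn] at hn
    refine ⟨⟨max (N+1) (p.1 n + 1), fun i => if i < N then w i else
      (((t i : ℤ) + 1) * d1, ((t i : ℤ) + 1) * d2), ?_⟩, ?_, ?_, n, ?_, ?_⟩
    · intro i
      by_cases h : i < N
      · simpa [h] using hw i
      · simp only [h, if_false]
        exact hd.imp (hbig i d1) (hbig i d2)
    · simp
    · intro i hi
      simp at hi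
      simp [hi]
    · simp
    · intro i hi
      have h0 := hn i hi
      dsimp only at hi ⊢
      by_cases h : i < N
      · simp only [h, if_true]
        have h1 : |a * (w i).1 + b * (w i).2| ≤ B :=
          Finset.single_le_sum (f := fun i => |a * (w i).1 + b * (w i).2|)
            (fun _ _ => abs_nonneg _) (Finset.mem_range.2 h)
        have h2 := abs_add_le (x i) (a * (w i).1 + b * (w i).2)
        rw [← add_assoc] at h2
        linarith
      · simp only [h, if_false]
        have : x i + a * (((t i : ℤ) + 1) * d1) + b * (((t i : ℤ) + 1) * d2) = x i := by
          linear_combination ((t i : ℤ) + 1) * hd0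
        rw [this]
        linarith
  choose nxt hn1 hn2 hn3 using key
  let s0 : S := ⟨0, fun i => ((t i : ℤ) + 1, 0), fun i =>
    Or.inl (lt_of_lt_of_le (lt_add_one _) (le_abs_self _))⟩
  let s : ℕ → S := fun j => Nat.rec s0 (fun j s => nxt (e j) s) j
  have hs : ∀ j, s (j+1) = nxt (e j) (s j) := fun j => rfl
  have hmono : StrictMono fun j => (s j).1 := strictMono_nat_of_lt_succ fun j => by
    rw [hs]; exact hn1 _ _
  have hst : ∀ j j', j ≤ j' → ∀ i < (s j).1, (s j').2.1 i = (s j).2.1 i := by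
    intro j j' hj
    induction j', hj using Nat.le_induction with
    | base => intros; rfl
    | succ m hm ih =>
      intro i hi
      rw [hs, hn2 _ _ i (lt_of_lt_of_le hi (hmono.monotone hm)), ih i hi]
  have hlim : ∀ j i, i < (s j).1 → (s (i+1)).2.1 i = (s j).2.1 i := by
    intro j i hi
    rcases le_total j (i+1) with h | h
    · exact hst _ _ h i hi
    · exact (hst _ _ h i (lt_of_lt_of_le (Nat.lt_succ_self i) (hmono.id_le (i+1)))).symm
  refine ⟨fun i => ((s (i+1)).2.1 i).1, fun i => ((s (i+1)).2.1 i).2,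
    fun i => (s (i+1)).2.2 i, ?_⟩
  intro p hp x hx a b C
  obtain ⟨j, hj⟩ := he (⟨p, hp⟩, ⟨x, hx⟩, a, b, C)
  obtain ⟨n, h1, h2⟩ := hn3 (e j) (s j)
  rw [← hs, hj] at h1 h2
  refine ⟨n, fun i hi => ?_⟩
  have := h2 i hi
  rw [← hlim (j+1) i (lt_of_le_of_lt hi h1)] at this
  simpa using this

def gens {I : Type*} (D : I → (ℕ → ℤ) × (ℕ → ℤ) × (ℕ → ℤ)) (A : Set I) : Set (ℕ → ℤ) :=
  (fun i => (D i).2.1) '' A ∪ (fun i => (D i).2.2) '' A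

lemma gens_mono {I : Type*} (D : I → (ℕ → ℤ) × (ℕ → ℤ) × (ℕ → ℤ)) {A B : Set I} (h : A ⊆ B) :
    gens D A ⊆ gens D B :=
  Set.union_subset_union (Set.image_mono h) (Set.image_mono h)

lemma exists_mem_Iic {I : Type*} [LinearOrder I] (D : I → (ℕ → ℤ) × (ℕ → ℤ) × (ℕ → ℤ))
    (A : Set I) (i0 : I) (h0 : i0 ∈ A) (x : ℕ → ℤ) (hx : x ∈ AddSubgroup.closure (gens D A)) :
    ∃ m ∈ A, i0 ≤ m ∧ x ∈ AddSubgroup.closure (gens D (Set.Iic m)) := by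
  have mono : ∀ {m m' : I}, m ≤ m' → AddSubgroup.closure (gens D (Set.Iic m)) ≤
      AddSubgroup.closure (gens D (Set.Iic m')) := fun h =>
    AddSubgroup.closure_mono (gens_mono D (Set.Iic_subset_Iic.2 h))
  have hmax : ∀ {m m' : I}, m ∈ A → m' ∈ A → max m m' ∈ A := by
    intro m m' h h'
    rcases max_choice m m' with e | e <;> rw [e] <;> assumption
  induction hx using AddSubgroup.closure_induction with
  | mem x hx =>
    rcases hx with ⟨i, hi, rfl⟩ | ⟨i, hi, rfl⟩
    · exact ⟨max i0 i, hmax h0 hi, le_max_left _ _, AddSubgroup.subset_closure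
        (Or.inl ⟨i, le_max_right _ _, rfl⟩)⟩
    · exact ⟨max i0 i, hmax h0 hi, le_max_left _ _, AddSubgroup.subset_closure
        (Or.inr ⟨i, le_max_right _ _, rfl⟩)⟩
  | zero => exact ⟨i0, h0, le_rfl, zero_mem _⟩
  | add x y _ _ hx hy =>
    obtain ⟨m, h1, h2, h3⟩ := hx
    obtain ⟨m', h1', h2', h3'⟩ := hy
    exact ⟨max m m', hmax h1 h1', le_max_of_le_left h2,
      add_mem (mono (le_max_left _ _) h3) (mono (le_max_right _ _) h3')⟩
  | neg x _ hx =>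
    obtain ⟨m, h1, h2, h3⟩ := hx
    exact ⟨m, h1, h2, neg_mem h3⟩

lemma mem_closure_Iic {I : Type*} [LinearOrder I] (D : I → (ℕ → ℤ) × (ℕ → ℤ) × (ℕ → ℤ))
    (m : I) (x : ℕ → ℤ) (hx : x ∈ AddSubgroup.closure (gens D (Set.Iic m))) :
    ∃ y ∈ AddSubgroup.closure (gens D (Set.Iio m)), ∃ a b : ℤ,
      x = y + a • (D m).2.1 + b • (D m).2.2 := by
  induction hx using AddSubgroup.closure_induction with
  | mem x hx =>
    rcases hx with ⟨i, hi, rfl⟩ | ⟨i, hi, rfl⟩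
    · rcases eq_or_lt_of_le (Set.mem_Iic.1 hi) with rfl | h
      · exact ⟨0, zero_mem _, 1, 0, by simp⟩
      · exact ⟨_, AddSubgroup.subset_closure (Or.inl ⟨i, h, rfl⟩), 0, 0, by simp⟩
    · rcases eq_or_lt_of_le (Set.mem_Iic.1 hi) with rfl | h
      · exact ⟨0, zero_mem _, 0, 1, by simp⟩
      · exact ⟨_, AddSubgroup.subset_closure (Or.inr ⟨i, h, rfl⟩), 0, 0, by simp⟩
  | zero => exact ⟨0, zero_mem _, 0, 0, by simp⟩
  | add x y _ _ hx hy =>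
    obtain ⟨u, hu, a, b, rfl⟩ := hx
    obtain ⟨v, hv, c, d, rfl⟩ := hy
    exact ⟨u + v, add_mem hu hv, a + c, b + d, by module⟩
  | neg x _ hx =>
    obtain ⟨u, hu, a, b, rfl⟩ := hx
    exact ⟨-u, neg_mem hu, -a, -b, by module⟩

lemma main_rec {I : Type*} [LinearOrder I] [WellFoundedLT I]
    (hc : ∀ i : I, (Set.Iio i).Countable) (τ : I → ℕ → ℕ) :
    ∃ D : I → (ℕ → ℤ) × (ℕ → ℤ) × (ℕ → ℤ),
      (∀ i n, (τ i n : ℤ) < |(D i).2.1 n| ∨ (τ i n : ℤ) < |(D i).2.2 n|) ∧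
      ∀ i, ∀ x ∈ AddSubgroup.closure (gens D Set.univ), OKp (τ i) (D i).1 x := by
  classical
  let V := (ℕ → ℤ) × (ℕ → ℤ) × (ℕ → ℤ)
  let Hp : ∀ i : I, (∀ j, j < i → V) → Set (ℕ → ℤ) := fun i prev =>
    AddSubgroup.closure {x | ∃ j, ∃ h : j < i, x = (prev j h).2.1 ∨ x = (prev j h).2.2}
  let R : ∀ i : I, (∀ j, j < i → V) → V → Prop := fun i prev v =>
    (∀ n, (τ i n : ℤ) < |v.2.1 n| ∨ (τ i n : ℤ) < |v.2.2 n|) ∧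
    ∀ x ∈ Hp i prev, ∀ a b : ℤ, OKp (τ i) v.1 (x + a • v.2.1 + b • v.2.2) ∧
      ∀ j (h : j < i), OKp (τ j) (prev j h).1 (x + a • v.2.1 + b • v.2.2)
  let step : ∀ i : I, (∀ j, j < i → V) → V := fun i prev =>
    if h : ∃ v, R i prev v then h.choose else (0, 0, 0)
  let D : I → V := (wellFounded_lt (α := I)).fix step
  have hD : ∀ i, (∃ v, R i (fun j _ => D j) v) → R i (fun j _ => D j) (D i) := by
    intro i h
    have e : D i = step i (fun j _ => D j) := (wellFounded_lt (α := I)).fix_eq step i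
    rw [e]
    simp only [step, dif_pos h]
    exact h.choose_spec
  have hHp : ∀ i, Hp i (fun j _ => D j) = AddSubgroup.closure (gens D (Set.Iio i)) := by
    intro i
    simp only [Hp]
    congr 2
    ext x
    simp only [gens, Set.mem_ofPred_eq, Set.mem_union, Set.mem_image, Set.mem_Iio]
    constructor
    · rintro ⟨j, h, rfl | rfl⟩
      · exact Or.inl ⟨j, h, rfl⟩
      · exact Or.inr ⟨j, h, rfl⟩
    · rintro (⟨j, h, rfl⟩ | ⟨j, h, rfl⟩)
      · exact ⟨j, h, Or.inl rfl⟩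
      · exact ⟨j, h, Or.inr rfl⟩
  have hstep : ∀ i, (∀ j < i, ∀ x ∈ AddSubgroup.closure (gens D (Set.Iio i)),
      OKp (τ j) (D j).1 x) → R i (fun j _ => D j) (D i) := by
    intro i hi
    apply hD
    have hcount : (AddSubgroup.closure (gens D (Set.Iio i)) : Set (ℕ → ℤ)).Countable := by
      have : (gens D (Set.Iio i)).Countable := ((hc i).image _).union ((hc i).image _)
      have := this.to_subtype
      refine (Set.countable_range (FreeAbelianGroup.lift
        (Subtype.val : gens D (Set.Iio i) → ℕ → ℤ))).mono ?_
      have hle : AddSubgroup.closure (gens D (Set.Iio i)) ≤ (FreeAbelianGroup.lift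
          (Subtype.val : gens D (Set.Iio i) → ℕ → ℤ)).range := by
        rw [AddSubgroup.closure_le]
        intro x hx
        exact ⟨FreeAbelianGroup.of ⟨x, hx⟩, by simp⟩
      exact hle
    obtain ⟨f, hf⟩ := step1 _ hcount (τ i)
    obtain ⟨g, h, h1, h2⟩ := step2 _ hcount
      (insert (τ i, f) ((fun j => (τ j, (D j).1)) '' Set.Iio i))
      (((hc i).image _).insert _) (by
        rintro p (rfl | ⟨j, hj, rfl⟩) x hx
        · exact hf x hx
        · exact hi j hj x hx) (τ i)
    refine ⟨(f, g, h), h1, fun x hx a b => ?_⟩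
    rw [hHp] at hx
    exact ⟨h2 _ (Or.inl rfl) x hx a b, fun j hj => h2 _ (Or.inr ⟨j, hj, rfl⟩) x hx a b⟩
  have hIic : ∀ i, R i (fun j _ => D j) (D i) → ∀ j ≤ i,
      ∀ x ∈ AddSubgroup.closure (gens D (Set.Iic i)), OKp (τ j) (D j).1 x := by
    intro i hR j hj x hx
    obtain ⟨y, hy, a, b, rfl⟩ := mem_closure_Iic D i x hx
    have := hR.2 y (by rw [hHp]; exact hy) a b
    rcases eq_or_lt_of_le hj with rfl | h
    · exact this.1
    · exact this.2 j h
  have hall : ∀ i, R i (fun j _ => D j) (D i) := by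
    intro i
    induction i using WellFoundedLT.induction with
    | ind i ih =>
      apply hstep
      intro j hj x hx
      obtain ⟨m, hm, hjm, hxm⟩ := exists_mem_Iic D _ j hj x hx
      exact hIic m (ih m hm) j hjm x hxm
  refine ⟨D, fun i => (hall i).1, fun i x hx => ?_⟩
  obtain ⟨m, hm, hjm, hxm⟩ := exists_mem_Iic D _ i (Set.mem_univ i) x hx
  exact hIic m (hall m) i hjm x hxm

lemma nhds_basic (G : AddSubgroup (ℕ → ℤ)) (U : Set G) (hU : U ∈ 𝓝 (0 : G)) :
    ∃ k : ℕ, ∀ x : G, (∀ i ≤ k, x.1 i = 0) → x ∈ U := by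
  rw [nhds_subtype_eq_comap, mem_comap] at hU
  obtain ⟨W, hW, hWU⟩ := hU
  rw [nhds_pi, Filter.mem_pi] at hW
  obtain ⟨J, hJ, t, ht, hJt⟩ := hW
  obtain ⟨k, hk⟩ := hJ.bddAbove
  refine ⟨k, fun x hx => hWU (hJt fun i hi => ?_)⟩
  rw [hx i (hk hi)]
  exact mem_of_mem_nhds (ht i)

theorem menger_of (G : AddSubgroup (ℕ → ℤ))
    (h : ∀ k : ℕ → ℕ, ∃ f : ℕ → ℤ, ∀ x ∈ G, OKp k f x) : MengerBoundedAdd G := by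
  intro U hU
  choose k hk using fun n => nhds_basic G (U n) (hU n)
  obtain ⟨f, hf⟩ := h k
  have fin : ∀ n, ∃ F : Finset G, ∀ x : G, (∀ i ≤ k n, |x.1 i| ≤ f n) →
      ∃ y ∈ F, ∀ i ≤ k n, x.1 i = y.1 i := by
    intro n
    let r : G → (Fin (k n + 1) → ℤ) := fun x i => x.1 i
    let A : Set G := {x | ∀ i ≤ k n, |x.1 i| ≤ f n}
    have hA : (r '' A).Finite := by
      apply (Set.Finite.pi' (fun _ : Fin (k n + 1) => Set.finite_Icc (-f n) (f n))).subset
      rintro _ ⟨x, hx, rfl⟩ i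
      exact abs_le.1 (hx i (by omega))
    classical
    refine ⟨hA.toFinset.image (Function.invFunOn r A), fun x hx => ?_⟩
    have hm : r x ∈ r '' A := ⟨x, hx, rfl⟩
    refine ⟨Function.invFunOn r A (r x),
      Finset.mem_image_of_mem _ (hA.mem_toFinset.2 hm), fun i hi => ?_⟩
    exact (congrFun (Function.invFunOn_eq hm) ⟨i, by omega⟩).symm
  choose F hF using fin
  refine ⟨F, fun x => ?_⟩
  obtain ⟨n, hn⟩ := hf x x.2 0
  obtain ⟨y, hy, hxy⟩ := hF n x (by simpa using hn)
  refine ⟨n, Set.mem_add.2 ⟨y, hy, -y + x, hk n _ fun i hi => ?_, by simp⟩⟩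
  simp [hxy i hi]

theorem not_scheepers_of (G : AddSubgroup (ℕ → ℤ))
    (h : ∀ t : ℕ → ℕ, ∃ g ∈ G, ∃ h ∈ G, ∀ n, (t n : ℤ) < |g n| ∨ (t n : ℤ) < |h n|) :
    ¬ ScheepersBoundedAdd G := by
  classical
  intro hS
  obtain ⟨F, hF⟩ := hS (fun n => {x | x.1 n = 0}) (fun n => by
    have hcont : Continuous fun x : G => x.1 n := (continuous_apply n).comp continuous_subtype_val
    exact (isOpen_discrete ({0} : Set ℤ)).preimage hcont |>.mem_nhds (by simp))
  obtain ⟨g, hg, h, hh, hgh⟩ := h fun n => ∑ y ∈ F n, (y.1 n).natAbs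
  obtain ⟨n, hn⟩ := hF {⟨g, hg⟩, ⟨h, hh⟩}
  have key : ∀ z : G, z ∈ (F n : Set G) + {x : G | x.1 n = 0} →
      |z.1 n| ≤ ((∑ y ∈ F n, (y.1 n).natAbs : ℕ) : ℤ) := by
    intro z hz
    obtain ⟨y, hy, u, hu, rfl⟩ := Set.mem_add.1 hz
    have h0 : (y + u).1 n = y.1 n := by
      have : u.1 n = 0 := hu
      simp [this]
    rw [h0, Int.abs_eq_natAbs]
    exact_mod_cast Finset.single_le_sum (f := fun y : G => (y.1 n).natAbs)
      (fun _ _ => Nat.zero_le _) hy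
  have k1 := key ⟨g, hg⟩ (hn (by simp))
  have k2 := key ⟨h, hh⟩ (hn (by simp))
  rcases hgh n with h | h
  · exact absurd k1 (not_le.2 h)
  · exact absurd k2 (not_le.2 h)

/-- Under CH, there is a Menger-bounded metrizable group (a subgroup of `ℤ^ℕ`)
which is not Scheepers-bounded. -/
theorem stmt17 (CH : 2 ^ Cardinal.aleph0 = Cardinal.aleph 1) :
    ∃ G : AddSubgroup (ℕ → ℤ),
      TopologicalSpace.MetrizableSpace G ∧
      MengerBoundedAdd G ∧ ¬ ScheepersBoundedAdd G := by
  let I : Type := (Cardinal.mk (ℕ → ℕ)).ord.ToType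
  have hI : Cardinal.mk I = Cardinal.mk (ℕ → ℕ) := by simp [I]
  obtain ⟨τ⟩ := Cardinal.eq.1 hI
  have hcard : Cardinal.mk (ℕ → ℕ) = Cardinal.aleph 1 := by
    have CH' : (2 : Cardinal.{0}) ^ Cardinal.aleph0.{0} = Cardinal.aleph 1 := by
      apply Cardinal.lift_injective
      simpa using CH
    simp [← CH']
  have hc : ∀ i : I, (Set.Iio i).Countable := by
    intro i
    have := Cardinal.mk_Iio_lt i (by simp [I])
    replace this := lt_of_lt_of_eq this (hI.trans hcard)
    rw [← Cardinal.succ_aleph0, Order.lt_succ_iff] at this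
    exact Cardinal.le_aleph0_iff_set_countable.1 this
  obtain ⟨D, h1, h2⟩ := main_rec hc τ
  have hsc : SecondCountableTopology (ℕ → ℤ) := inferInstance
  have hsc2 : SecondCountableTopology (AddSubgroup.closure (gens D Set.univ)) :=
    Topology.IsEmbedding.subtypeVal.secondCountableTopology
  refine ⟨AddSubgroup.closure (gens D Set.univ), TopologicalSpace.metrizableSpace_of_t3_secondCountable _, menger_of _ fun k => ?_,
    not_scheepers_of _ fun t => ?_⟩
  · refine ⟨(D (τ.symm k)).1, fun x hx => ?_⟩
    simpa using h2 (τ.symm k) x hx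
  · refine ⟨(D (τ.symm t)).2.1, AddSubgroup.subset_closure (Or.inl ⟨_, trivial, rfl⟩),
      (D (τ.symm t)).2.2, AddSubgroup.subset_closure (Or.inr ⟨_, trivial, rfl⟩), ?_⟩
    simpa using h1 (τ.symm t)
end

section
/- Let 𝔡 be the dominating number and suppose there is a partition 𝒫 of ℕ (into sets each containing infinitely many consecutive pairs) with 𝔡'(𝒫) = 𝔡. Then for each natural number k ≥ 1 there exists a subgroup G of ℤ^ℕ such that G^k is Menger-bounded but G^{k+1} is not Menger-bounded. -/
open Pointwise Filter Topology

/-- The dominating number `𝔡`. -/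
noncomputable def dNumber : Cardinal :=
  sInf {c : Cardinal | ∃ Y : Set (ℕ → ℕ), Cardinal.mk Y = c ∧
    ∀ f : ℕ → ℕ, ∃ g ∈ Y, ∀ᶠ n in atTop, f n ≤ g n}

namespace MB

/-- A tuple is good if it is bounded by `m` on `[0,m)` for infinitely many `m`. -/
def Good {k : ℕ} (F : Fin k → ℕ → ℤ) : Prop :=
  ∀ N : ℕ, ∃ m, N ≤ m ∧ ∀ a, ∀ i < m, |F a i| ≤ m

theorem nhds_basis {k : ℕ} (G : AddSubgroup (ℕ → ℤ)) (U : Set (Fin k → G))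
    (hU : U ∈ 𝓝 (0 : Fin k → G)) :
    ∃ p : ℕ, ∀ x : Fin k → G, (∀ a, ∀ i < p, (x a : ℕ → ℤ) i = 0) → x ∈ U := by
  have h1 : 𝓝 (0 : Fin k → G) = Filter.pi fun a => Filter.comap (Subtype.val) (Filter.pi fun i : ℕ => pure (0:ℤ)) := by
    rw [nhds_pi]
    congr 1
    ext1 a
    rw [nhds_induced, nhds_pi]
    simp only [nhds_discrete]
    rfl
  rw [h1, Filter.mem_pi] at hU
  obtain ⟨J, hJ, t, ht, hsub⟩ := hU
  have h2 : ∀ a, ∃ p : ℕ, ∀ x : G, (∀ i < p, (x : ℕ → ℤ) i = 0) → x ∈ t a := by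
    intro a
    obtain ⟨s, hs, hst⟩ := Filter.mem_comap.1 (ht a)
    rw [Filter.mem_pi] at hs
    obtain ⟨J', hJ', t', ht', hsub'⟩ := hs
    obtain ⟨b, hb⟩ := hJ'.bddAbove
    refine ⟨b + 1, fun x hx => hst (hsub' ?_)⟩
    intro i hi
    rw [hx i (Nat.lt_succ_of_le (hb hi))]
    exact Filter.mem_pure.1 (ht' i)
  choose p hp using h2
  obtain ⟨M, hM⟩ := Finite.exists_le p
  refine ⟨M, fun x hx => hsub fun a _ => hp a _ fun i hi => hx a i (hi.trans_le (hM a))⟩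

theorem menger_of_good {k : ℕ} (G : AddSubgroup (ℕ → ℤ))
    (hG : ∀ F : Fin k → ℕ → ℤ, (∀ a, F a ∈ G) → Good F) :
    MengerBoundedAdd (Fin k → G) := by
  intro U hU
  choose p₀ hp₀ using fun n => nhds_basis G (U n) (hU n)
  let p : ℕ → ℕ := fun n => n + ∑ i ∈ Finset.range (n+1), p₀ i
  have hp : StrictMono p := by
    apply strictMono_nat_of_lt_succ
    intro n
    simp only [p]
    rw [Finset.sum_range_succ _ (n+1)]
    omega
  have hpp : ∀ n, p₀ n ≤ p n := by
    intro n
    simp only [p]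
    rw [Finset.sum_range_succ]
    omega
  let r : ∀ n, (Fin k → G) → (Fin k → Fin (p n) → ℤ) := fun n x a i => (x a : ℕ → ℤ) i
  let S : ℕ → Set (Fin k → G) := fun n => {x | ∀ a, ∀ i < p n, |(x a : ℕ → ℤ) i| ≤ p (n+1)}
  have hfin : ∀ n, (r n '' S n).Finite := by
    intro n
    apply Set.Finite.subset (Set.finite_Icc (fun _ _ => -(p (n+1) : ℤ)) (fun _ _ => (p (n+1) : ℤ)))
    rintro _ ⟨x, hx, rfl⟩
    constructor
    · intro a i
      exact (abs_le.1 (hx a i i.2)).1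
    · intro a i
      exact (abs_le.1 (hx a i i.2)).2
  have hex : ∀ n, ∃ T : Finset (Fin k → G), ∀ x ∈ S n, ∃ y ∈ T, r n x = r n y := by
    intro n
    classical
    choose! g hg using fun y (hy : y ∈ r n '' S n) => hy
    refine ⟨(hfin n).toFinset.image g, fun x hx => ?_⟩
    have hm : r n x ∈ r n '' S n := ⟨x, hx, rfl⟩
    exact ⟨g (r n x), Finset.mem_image_of_mem _ (by simpa using hm), (hg _ hm).2.symm⟩
  choose T hT using hex
  refine ⟨T, fun x => ?_⟩
  obtain ⟨m, hm, hm2⟩ := hG (fun a => x a) (fun a => (x a).2) (p 0)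
  obtain ⟨n, hn1, hn2⟩ : ∃ n, p n ≤ m ∧ m < p (n+1) := by
    have hE : ∃ n, m < p n := ⟨m+1, (Nat.lt_succ_self m).trans_le (hp.le_apply)⟩
    classical
    have h0 : Nat.find hE ≠ 0 := by
      intro h
      have := Nat.find_spec hE
      rw [h] at this
      omega
    obtain ⟨n, hn⟩ := Nat.exists_eq_succ_of_ne_zero h0
    refine ⟨n, ?_, ?_⟩
    · have := Nat.find_min hE (m := n) (by omega)
      omega
    · have := Nat.find_spec hE
      rwa [hn] at this
  refine ⟨n, ?_⟩
  obtain ⟨y, hy, hxy⟩ := hT n x (by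
    intro a i hi
    have h1 := hm2 a i (by omega)
    have h2 : (m : ℤ) ≤ p (n+1) := by exact_mod_cast hn2.le
    exact h1.trans h2)
  refine Set.mem_add.2 ⟨y, hy, x - y, ?_, by abel⟩
  apply hp₀
  intro a i hi
  have := congrFun (congrFun hxy a) ⟨i, hi.trans_le (hpp n)⟩
  simp only [r] at this
  simp [this]

theorem not_menger {k : ℕ} (G : AddSubgroup (ℕ → ℤ))
    (hG : ∀ d : ℕ → ℕ, ∃ F : Fin k → ℕ → ℤ, (∀ a, F a ∈ G) ∧
      ∀ᶠ n in atTop, ∃ i < n, ∃ j, (d n : ℤ) < |F j i|) :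
    ¬ MengerBoundedAdd (Fin k → G) := by
  intro hM
  let V : ℕ → Set (Fin k → G) := fun n => {x | ∀ a, ∀ i < n, (x a : ℕ → ℤ) i = 0}
  have hV : ∀ n, V n ∈ 𝓝 (0 : Fin k → G) := by
    intro n
    have hc : ∀ a : Fin k, ∀ i : ℕ, Continuous fun x : Fin k → G => (x a : ℕ → ℤ) i := by
      intro a i
      exact (continuous_apply i).comp (continuous_subtype_val.comp (continuous_apply a))
    have ho : IsOpen (V n) := by
      have : V n = ⋂ a : Fin k, ⋂ i ∈ Set.Iio n, {x : Fin k → G | (x a : ℕ → ℤ) i = 0} := by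
        ext x
        simp [V]
      rw [this]
      refine isOpen_iInter_of_finite fun a => (Set.finite_Iio n).isOpen_biInter fun i _ => ?_
      exact (isOpen_discrete ({0} : Set ℤ)).preimage (hc a i)
    apply ho.mem_nhds
    intro a i _
    simp
  choose T hT using fun n₀ => hM (fun n => V (n₀ + n)) (fun n => hV _)
  let d : ℕ → ℕ := fun n => ∑ n₀ ∈ Finset.range (n+1), ∑ y ∈ T n₀ (n - n₀),
    ∑ a : Fin k, ∑ i ∈ Finset.range n, ((y a : ℕ → ℤ) i).natAbs
  obtain ⟨F, hF, hev⟩ := hG d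
  obtain ⟨n₀, hn₀⟩ := eventually_atTop.1 hev
  obtain ⟨n, hn⟩ := hT n₀ (fun a => ⟨F a, hF a⟩)
  obtain ⟨y, hy, z, hz, hyz⟩ := Set.mem_add.1 hn
  obtain ⟨i, hi, j, hj⟩ := hn₀ (n₀ + n) (by omega)
  have h1 : F j i = (y j : ℕ → ℤ) i := by
    have := congrArg (fun w : Fin k → G => (w j : ℕ → ℤ) i) hyz
    simp only [Pi.add_apply, AddSubgroup.coe_add] at this
    rw [← this, hz j i hi, add_zero]
  rw [h1, Int.abs_eq_natAbs] at hj
  have hj' : d (n₀ + n) < ((y j : ℕ → ℤ) i).natAbs := by exact_mod_cast hj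
  apply absurd hj'
  push Not
  have e1 : ((y j : ℕ → ℤ) i).natAbs ≤ ∑ i ∈ Finset.range (n₀ + n), ((y j : ℕ → ℤ) i).natAbs :=
    Finset.single_le_sum (f := fun i => ((y j : ℕ → ℤ) i).natAbs) (fun _ _ => Nat.zero_le _)
      (Finset.mem_range.2 hi)
  refine e1.trans ?_
  have e2 := Finset.single_le_sum
    (f := fun j => ∑ i ∈ Finset.range (n₀ + n), ((y j : ℕ → ℤ) i).natAbs)
    (fun _ _ => Nat.zero_le _) (Finset.mem_univ j)
  refine e2.trans ?_
  have e3 := Finset.single_le_sum (s := T n₀ n)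
    (f := fun y => ∑ j, ∑ i ∈ Finset.range (n₀ + n), ((y j : ℕ → ℤ) i).natAbs)
    (fun _ _ => Nat.zero_le _) hy
  refine e3.trans ?_
  have e4 := Finset.single_le_sum (s := Finset.range (n₀ + n + 1))
    (f := fun m => ∑ y ∈ T m (n₀ + n - m),
      ∑ j, ∑ i ∈ Finset.range (n₀ + n), ((y j : ℕ → ℤ) i).natAbs)
    (fun _ _ => Nat.zero_le _) (Finset.mem_range.2 (by omega : n₀ < n₀ + n + 1))
  simp only [Nat.add_sub_cancel_left] at e4
  exact e4

theorem dNumber_spec : ∃ Y : Set (ℕ → ℕ), Cardinal.mk Y = dNumber ∧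
    ∀ f : ℕ → ℕ, ∃ g ∈ Y, ∀ᶠ n in atTop, f n ≤ g n := by
  have := csInf_mem (s := {c : Cardinal | ∃ Y : Set (ℕ → ℕ), Cardinal.mk Y = c ∧
    ∀ f : ℕ → ℕ, ∃ g ∈ Y, ∀ᶠ n in atTop, f n ≤ g n})
    ⟨_, Set.univ, rfl, fun f => ⟨f, trivial, Eventually.of_forall fun _ => le_rfl⟩⟩
  exact this

theorem aleph0_lt_dNumber : Cardinal.aleph0 < dNumber := by
  obtain ⟨Y, hY, hdom⟩ := dNumber_spec
  by_contra hlt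
  push Not at hlt
  rw [← hY, Cardinal.mk_le_aleph0_iff] at hlt
  have : Nonempty Y := by
    obtain ⟨g, hg, _⟩ := hdom 0
    exact ⟨⟨g, hg⟩⟩
  obtain ⟨y, hy⟩ := exists_surjective_nat Y
  obtain ⟨g, hg, hev⟩ := hdom fun n => 1 + ∑ i ∈ Finset.range (n+1), (y i : ℕ → ℕ) n
  obtain ⟨j, hj⟩ := hy ⟨g, hg⟩
  obtain ⟨n₀, hn₀⟩ := eventually_atTop.1 hev
  have h1 := hn₀ (n₀ + j) (by omega)
  have h2 := Finset.single_le_sum (s := Finset.range (n₀ + j + 1))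
    (f := fun i => (y i : ℕ → ℕ) (n₀ + j))
    (fun _ _ => Nat.zero_le _) (Finset.mem_range.2 (by omega : j < n₀ + j + 1))
  simp only [hj] at h2
  omega

theorem mk_span_le {M : Type} [AddCommGroup M] (s : Set M) :
    Cardinal.mk (Submodule.span ℤ s) ≤ max (Cardinal.mk s) Cardinal.aleph0 := by
  rcases s.eq_empty_or_nonempty with rfl | hs
  · refine le_max_of_le_right ?_
    rw [Cardinal.mk_le_aleph0_iff, Submodule.span_empty]
    infer_instance
  have : Nonempty s := hs.to_subtype
  have h : Cardinal.mk (s →₀ ℤ) = max (Cardinal.mk s) Cardinal.aleph0 := by simp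
  rw [← h]
  have h2 := Finsupp.range_linearCombination ℤ (v := (Subtype.val : s → M))
  rw [Subtype.range_coe] at h2
  rw [← h2]
  exact Cardinal.mk_range_le (f := Finsupp.linearCombination ℤ (Subtype.val : s → M))

/-- The requirement on the new generators. -/
def P {k : ℕ} (N : Submodule ℤ (ℕ → ℤ)) (d : ℕ → ℕ) (e : Fin (k+1) → ℕ → ℤ) : Prop :=
  (∀ F : Fin k → ℕ → ℤ, (∀ a, F a ∈ N) → ∀ A : Fin k → Fin (k+1) → ℤ,
    Good (fun a => F a + ∑ j, A a j • e j)) ∧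
  ∀ᶠ n in atTop, ∃ i < n, ∃ j, (d n : ℤ) < |e j i|

theorem exists_ker {k : ℕ} (hk : 1 ≤ k) (A : Fin k → Fin (k+1) → ℤ) :
    ∃ v : Fin (k+1) → ℤ, v ≠ 0 ∧ ∀ a, ∑ j, A a j * v j = 0 := by
  obtain ⟨t, h0, h1, -⟩ := Int.Matrix.exists_ne_zero_int_vec_norm_le (Matrix.of A)
    (by simp) (by simp; omega)
  exact ⟨t, h0, fun a => congrFun h1 a⟩

theorem step (I : ℕ → Set ℕ)
    (hpart : ∀ n : ℕ, ∃! l, n ∈ I l) {k : ℕ} (hk : 1 ≤ k)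
    (N : Submodule ℤ (ℕ → ℤ)) (hN : max (Cardinal.mk N) Cardinal.aleph0 < dPrime I)
    (hgood : ∀ F : Fin k → ℕ → ℤ, (∀ a, F a ∈ N) → Good F) (d : ℕ → ℕ) :
    ∃ e : Fin (k+1) → ℕ → ℤ, P N d e := by
  classical
  obtain ⟨A, hA⟩ := exists_surjective_nat (Fin k → Fin (k+1) → ℤ)
  choose v hv0 hv using fun l => exists_ker hk (A l)
  choose L hL hLu using hpart
  let D : ℕ → ℕ := fun n => 1 + ∑ i ∈ Finset.range (n+1), d i
  have hD : Monotone D := by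
    apply monotone_nat_of_le_succ
    intro n
    simp only [D]
    rw [Finset.sum_range_succ _ (n+1)]
    omega
  have hdD : ∀ n, d n < D n := by
    intro n
    simp only [D]
    rw [Finset.sum_range_succ]
    omega
  let W : ℕ → ℕ := fun x => ∑ n ∈ Finset.range x, ∑ j, (v (L n) j).natAbs
  have hW : Monotone W := by
    apply monotone_nat_of_le_succ
    intro n
    simp only [W]
    rw [Finset.sum_range_succ _ n]
    omega
  have hvW : ∀ n j, (v (L n) j).natAbs ≤ W (n+1) := by
    intro n j
    simp only [W]
    rw [Finset.sum_range_succ]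
    have := Finset.single_le_sum (f := fun j => (v (L n) j).natAbs)
      (fun _ _ => Nat.zero_le _) (Finset.mem_univ j)
    beta_reduce at this
    omega
  have hφ : ∀ F : Fin k → N, ∀ x : ℕ, ∃ m : ℕ, 2 * (x * W x * D x) + x + 1 ≤ m ∧
      ∀ a, ∀ i < m, 2 * |(F a : ℕ → ℤ) i| ≤ m := by
    intro F x
    obtain ⟨m, hm, hm2⟩ := hgood (fun a => (2:ℤ) • (F a : ℕ → ℤ))
      (fun a => N.smul_mem _ (F a).2) (2 * (x * W x * D x) + x + 1)
    refine ⟨m, hm, fun a i hi => ?_⟩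
    have := hm2 a i hi
    simpa [abs_mul] using this
  choose φ hφ1 hφ2 using hφ
  have hcard : Cardinal.mk (Set.range φ) < dPrime I := by
    refine lt_of_le_of_lt (Cardinal.mk_range_le.trans ?_) hN
    have : Cardinal.mk (Fin k → N) = Cardinal.mk N ^ (k : Cardinal) := by simp
    rw [this]
    exact Cardinal.power_nat_le_max
  have hnot := notMem_of_lt_csInf' hcard
  have hex : ∃ h : ℕ → ℕ, StrictMono h ∧ ∀ f ∈ Set.range φ, ∀ l,
      {n : ℕ | n ∈ I l ∧ n + 1 ∈ I l ∧
        f (h n) < h (n + 1) ∧ f (h (n + 1)) < h (n + 2)}.Infinite := by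
    by_contra hne
    exact hnot ⟨_, rfl, hne⟩
  obtain ⟨h, hh, hY'⟩ := hex
  have hY := fun F => hY' (φ F) ⟨F, rfl⟩
  let e : Fin (k+1) → ℕ → ℤ := fun j i =>
    if H : ∃ n, h n = i then v (L H.choose) j * D (h (H.choose + 1)) else 0
  have he : ∀ j n, e j (h n) = v (L n) j * D (h (n+1)) := by
    intro j n
    have H : ∃ n', h n' = h n := ⟨n, rfl⟩
    have : H.choose = n := hh.injective H.choose_spec
    simp only [e, dif_pos H, this]
  have he0 : ∀ j i, (∀ n, h n ≠ i) → e j i = 0 := by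
    intro j i hi
    have : ¬ ∃ n, h n = i := by push Not; exact hi
    simp only [e, dif_neg this]
  refine ⟨e, ?_, ?_⟩
  · intro F hF B N₀
    obtain ⟨l, rfl⟩ := hA B
    let C : ℕ := ∑ a, ∑ j, (A l a j).natAbs
    obtain ⟨n, hn, hnN⟩ := (hY (fun a => ⟨F a, hF a⟩) l).exists_gt (N₀ + C)
    obtain ⟨hnI, -, hlt, -⟩ := hn
    have hLn : L n = l := (hLu n l hnI).symm
    have hnh : n ≤ h n := hh.le_apply
    set m := φ (fun a => ⟨F a, hF a⟩) (h n) with hm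
    have hm1 := hφ1 (fun a => ⟨F a, hF a⟩) (h n)
    have hm2 := hφ2 (fun a => ⟨F a, hF a⟩) (h n)
    rw [← hm] at hm1 hm2
    refine ⟨m, by omega, fun a i hi => ?_⟩
    have key : 2 * |∑ j, A l a j * e j i| ≤ m := by
      by_cases hi2 : ∃ n', h n' = i
      · obtain ⟨n', rfl⟩ := hi2
        simp only [he]
        have hle : n' ≤ n := by
          have : h n' < h (n+1) := by omega
          have := hh.lt_iff_lt.1 this
          omega
        rcases hle.eq_or_lt with rfl | hlt'
        · have : ∑ j, A l a j * (v (L n') j * (D (h (n'+1)) : ℤ))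
              = (∑ j, A l a j * v l j) * (D (h (n'+1)) : ℤ) := by
            rw [hLn, Finset.sum_mul]
            exact Finset.sum_congr rfl fun j _ => by ring
          rw [this, hv]
          simp
        · have b1 : D (h (n'+1)) ≤ D (h n) := hD (hh.monotone hlt')
          have b2 : ∀ j, (v (L n') j).natAbs ≤ W (h n) := fun j =>
            (hvW n' j).trans (hW (le_trans hlt' hnh))
          have b3 : |∑ j, A l a j * (v (L n') j * (D (h (n'+1)) : ℤ))|
              ≤ ((∑ j, (A l a j).natAbs * (W (h n) * D (h n)) : ℕ) : ℤ) := by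
            refine (Finset.abs_sum_le_sum_abs _ _).trans ?_
            push_cast
            refine Finset.sum_le_sum fun j _ => ?_
            rw [Int.abs_eq_natAbs, Int.natAbs_mul, Int.natAbs_mul, Int.natAbs_natCast]
            have := Nat.mul_le_mul_left (A l a j).natAbs (Nat.mul_le_mul (b2 j) b1)
            have h3 : (((A l a j).natAbs * ((v (L n') j).natAbs * D (h (n'+1))) : ℕ) : ℤ) ≤
              (((A l a j).natAbs * (W (h n) * D (h n)) : ℕ) : ℤ) := by exact_mod_cast this
            simpa using h3
          have b4 : ∑ j, (A l a j).natAbs * (W (h n) * D (h n)) ≤ h n * W (h n) * D (h n) := by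
            rw [← Finset.sum_mul, mul_assoc]
            apply Nat.mul_le_mul_right
            have := Finset.single_le_sum (f := fun a => ∑ j, (A l a j).natAbs)
              (fun _ _ => Nat.zero_le _) (Finset.mem_univ a)
            beta_reduce at this
            omega
          have b5 : ((∑ j, (A l a j).natAbs * (W (h n) * D (h n)) : ℕ) : ℤ) ≤
            ((h n * W (h n) * D (h n) : ℕ) : ℤ) := by exact_mod_cast b4
          have b6 : ((2 * (h n * W (h n) * D (h n)) + h n + 1 : ℕ) : ℤ) ≤ m := by
            exact_mod_cast hm1
          push_cast at b6 b5 b3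
          have : (0:ℤ) ≤ h n := by positivity
          linarith
      · push Not at hi2
        simp [he0 _ i hi2]
    have key2 := hm2 a i hi
    have : (F a + ∑ j, A l a j • e j) i = F a i + ∑ j, A l a j * e j i := by
      simp
    show |(F a + ∑ j, A l a j • e j) i| ≤ m
    rw [this]
    have h3 := abs_add_le (F a i) (∑ j, A l a j * e j i)
    simp only at key2
    linarith
  · refine eventually_atTop.2 ⟨h 0 + 1, fun n hn => ?_⟩
    obtain ⟨q, hq1, hq2⟩ : ∃ q, h q < n ∧ n ≤ h (q+1) := by
      have hE : ∃ q, n ≤ h q := ⟨n, hh.le_apply⟩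
      have h0 : Nat.find hE ≠ 0 := by
        intro h'
        have := Nat.find_spec hE
        rw [h'] at this
        omega
      obtain ⟨q, hq⟩ := Nat.exists_eq_succ_of_ne_zero h0
      refine ⟨q, ?_, ?_⟩
      · have := Nat.find_min hE (m := q) (by omega)
        omega
      · have := Nat.find_spec hE
        rwa [hq] at this
    obtain ⟨j, hj⟩ := Function.ne_iff.1 (hv0 (L q))
    refine ⟨h q, hq1, j, ?_⟩
    rw [he, abs_mul]
    have h1 : (1:ℤ) ≤ |v (L q) j| := Int.one_le_abs hj
    have h2 : d n < D (h (q+1)) := (hdD n).trans_le (hD hq2)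
    have h3 : (d n : ℤ) < D (h (q+1)) := by exact_mod_cast h2
    rw [Nat.abs_cast]
    nlinarith

theorem good_span {k : ℕ} {ι : Type} [LinearOrder ι] (e : ι → Fin (k+1) → ℕ → ℤ)
    (d : ι → ℕ → ℕ) (T : Set ι)
    (hP : ∀ β ∈ T, P (Submodule.span ℤ {x | ∃ γ < β, ∃ j, x = e γ j}) (d β) (e β))
    (F : Fin k → ℕ → ℤ)
    (hF : ∀ a, F a ∈ Submodule.span ℤ {x | ∃ γ ∈ T, ∃ j, x = e γ j}) : Good F := by
  let M : ι → Submodule ℤ (ℕ → ℤ) := fun β => Submodule.span ℤ {x | ∃ γ ≤ β, ∃ j, x = e γ j}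
  have hM : Monotone M := by
    intro a b hab
    apply Submodule.span_mono
    rintro x ⟨γ, hγ, j, rfl⟩
    exact ⟨γ, hγ.trans hab, j, rfl⟩
  have hdec : ∀ β x, x ∈ M β → ∃ y ∈ Submodule.span ℤ {x | ∃ γ < β, ∃ j, x = e γ j},
      ∃ c : Fin (k+1) → ℤ, x = y + ∑ j, c j • e β j := by
    intro β x hx
    have : {x | ∃ γ ≤ β, ∃ j, x = e γ j} = {x | ∃ γ < β, ∃ j, x = e γ j} ∪ Set.range (e β) := by
      ext x
      simp only [Set.mem_ofPred_eq, Set.mem_union, Set.mem_range]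
      constructor
      · rintro ⟨γ, hγ, j, rfl⟩
        rcases hγ.eq_or_lt with rfl | h
        · exact Or.inr ⟨j, rfl⟩
        · exact Or.inl ⟨γ, h, j, rfl⟩
      · rintro (⟨γ, hγ, j, rfl⟩ | ⟨j, rfl⟩)
        · exact ⟨γ, hγ.le, j, rfl⟩
        · exact ⟨β, le_rfl, j, rfl⟩
    simp only [M] at hx
    rw [this, Submodule.span_union] at hx
    obtain ⟨y, hy, z, hz, rfl⟩ := Submodule.mem_sup.1 hx
    obtain ⟨c, hc⟩ := (Submodule.mem_span_range_iff_exists_fun ℤ).1 hz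
    exact ⟨y, hy, c, by rw [hc]⟩
  rcases T.eq_empty_or_nonempty with rfl | hT
  · have h0 : ∀ a, F a = 0 := by
      intro a
      simpa using hF a
    intro N
    exact ⟨N, le_rfl, fun a i _ => by simp [h0 a]⟩
  have hTn : Nonempty T := hT.to_subtype
  have hU : ∀ x ∈ Submodule.span ℤ {x | ∃ γ ∈ T, ∃ j, x = e γ j}, ∃ β : T, x ∈ M β := by
    intro x hx
    induction hx using Submodule.span_induction with
    | mem x hx =>
      obtain ⟨γ, hγ, j, rfl⟩ := hx
      exact ⟨⟨γ, hγ⟩, Submodule.subset_span ⟨γ, le_rfl, j, rfl⟩⟩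
    | zero => exact ⟨hTn.some, Submodule.zero_mem _⟩
    | add x y _ _ hx hy =>
      obtain ⟨β, hβ⟩ := hx
      obtain ⟨γ, hγ⟩ := hy
      refine ⟨max β γ, Submodule.add_mem _ (hM ?_ hβ) (hM ?_ hγ)⟩
      · exact le_max_left β γ
      · exact le_max_right β γ
    | smul c x _ hx =>
      obtain ⟨β, hβ⟩ := hx
      exact ⟨β, Submodule.smul_mem _ _ hβ⟩
  choose b hb using fun a => hU _ (hF a)
  obtain ⟨β, hβ⟩ := Finite.exists_le b
  choose y hy c hc using fun a => hdec β (F a) (hM (hβ a) (hb a))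
  have := (hP β β.2).1 y hy c
  convert this using 2 with a
  exact hc a

end MB

open MB in
theorem stmt19 (I : ℕ → Set ℕ)
    (hpart : ∀ n : ℕ, ∃! l, n ∈ I l)
    (hpairs : ∀ l, {n : ℕ | n ∈ I l ∧ n + 1 ∈ I l}.Infinite)
    (hd : dPrime I = dNumber) (k : ℕ) (hk : 1 ≤ k) :
    ∃ G : AddSubgroup (ℕ → ℤ),
      MengerBoundedAdd (Fin k → G) ∧ ¬ MengerBoundedAdd (Fin (k + 1) → G) := by
  classical
  obtain ⟨Y, hYc, hY⟩ := dNumber_spec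
  let ι := dNumber.ord.ToType
  have hι : Cardinal.mk ι = Cardinal.mk Y := by
    rw [hYc]
    simp [ι]
  obtain ⟨E⟩ := Cardinal.eq.1 hι
  let d : ι → ℕ → ℕ := fun α => E α
  let K : Submodule ℤ (ℕ → ℤ) → (ℕ → ℕ) → Fin (k+1) → ℕ → ℤ := fun N d =>
    Classical.epsilon fun e => P N d e
  have hwf : WellFounded ((· < ·) : ι → ι → Prop) := wellFounded_lt
  let e : ι → Fin (k+1) → ℕ → ℤ := hwf.fix fun α ih =>
    K (Submodule.span ℤ {x | ∃ β, ∃ h : β < α, ∃ j, x = ih β h j}) (d α)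
  have he : ∀ α, e α = K (Submodule.span ℤ {x | ∃ β < α, ∃ j, x = e β j}) (d α) := by
    intro α
    simp only [e]
    rw [hwf.fix_eq]
    simp only [exists_prop]
  have hP : ∀ α, P (Submodule.span ℤ {x | ∃ β < α, ∃ j, x = e β j}) (d α) (e α) := by
    intro α
    induction α using hwf.induction with
    | _ α ih =>
    have hex := step I hpart hk (Submodule.span ℤ {x | ∃ β < α, ∃ j, x = e β j}) (by
      rw [hd]
      refine max_lt ((mk_span_le _).trans_lt (max_lt ?_ aleph0_lt_dNumber)) aleph0_lt_dNumber
      have hsub : {x | ∃ β < α, ∃ j, x = e β j} =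
          Set.range fun q : Set.Iio α × Fin (k+1) => e q.1 q.2 := by
        ext x
        simp only [Set.mem_ofPred_eq, Set.mem_range, Prod.exists, Subtype.exists, Set.mem_Iio]
        constructor
        · rintro ⟨β, hβ, j, rfl⟩
          exact ⟨β, hβ, j, rfl⟩
        · rintro ⟨β, hβ, j, rfl⟩
          exact ⟨β, hβ, j, rfl⟩
      rw [hsub]
      refine Cardinal.mk_range_le.trans_lt ?_
      rw [Cardinal.mk_prod, Cardinal.lift_id, Cardinal.lift_id]
      exact Cardinal.mul_lt_of_lt aleph0_lt_dNumber.le (Cardinal.mk_Iio_toType_ord_lt α)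
        ((Cardinal.lt_aleph0_of_finite _).trans aleph0_lt_dNumber))
      (fun F hF => good_span e d (Set.Iio α) ih F hF) (d α)
    have := Classical.epsilon_spec hex
    rw [he α]
    exact this
  refine ⟨(Submodule.span ℤ {x | ∃ γ ∈ (Set.univ : Set ι), ∃ j, x = e γ j}).toAddSubgroup, ?_, ?_⟩
  · apply menger_of_good
    intro F hF
    exact good_span e d Set.univ (fun β _ => hP β) F hF
  · apply not_menger
    intro f
    obtain ⟨g, hg, hev⟩ := hY f
    let α : ι := E.symm ⟨g, hg⟩
    have hα : d α = g := by simp [d, α]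
    refine ⟨e α, fun a => Submodule.subset_span ⟨α, trivial, a, rfl⟩, ?_⟩
    filter_upwards [hev, (hP α).2] with n h1 ⟨i, hi, j, hj⟩
    refine ⟨i, hi, j, lt_of_le_of_lt ?_ hj⟩
    rw [hα]
    exact_mod_cast h1
end
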